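/- Fix positive integers d and κ with 2 ≤ κ ≤ d, and a constant L > 0. There exist a constant C (depending only on d, κ, L) and, for each sample size n ≥ 2, a measurable function f : (ℝ^d × ℝ)^n × ℝ^d → ℝ such that the following holds. Generate data by: drawing x₁, …, x_{n+1} i.i.d. from any Borel probability measure on [0,1]^d absolutely continuous with respect to Lebesgue measure with density p satisfying 0 < p_min ≤ p(x) ≤ p_max on [0,1]^d; drawing a subset S ⊆ {1, …, d} with |S| = κ uniformly at random; and setting yᵢ = π((xᵢ)_S). Then sup over all L-Lipschitz functions π : [0,1]^κ → [0,1] of E[(y_{n+1} − f((x₁,y₁), …, (xₙ,yₙ), x_{n+1}))²] ≤ C·( n^{−2/κ} + √( log(2·C(d,κ)) / n ) ), where C(d,κ) is the binomial coefficient 'd choose κ'. In particular the dominant term scales as O(n^{−2/κ}). -/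

import Mathlib

open MeasureTheory ENNReal

lemma aux_pack (κ N : ℕ) (u : Fin N → Fin κ → ℝ) (hu : ∀ i j, u i j ∈ Set.Icc (0:ℝ) 1)
    (r : Fin N → ℝ) (hr : ∀ i, 0 ≤ r i) (hr1 : ∀ i, r i ≤ 1)
    (hsep : ∀ i j, i ≠ j → r i ≤ dist (u i) (u j)) (hκ : κ ≠ 0) :
    ∑ i, r i ^ κ ≤ 2 ^ κ := by
  classical
  have hvol : ∀ i, volume (Metric.ball (u i) (r i / 2)) = ENNReal.ofReal (r i ^ κ) := by
    intro i
    rcases (hr i).eq_or_lt with h | h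
    · rw [← h]; simp [hκ]
    · rw [Real.volume_pi_ball _ (by positivity)]
      simp
      congr 1; ring
  have hdisj : Set.PairwiseDisjoint (↑(Finset.univ : Finset (Fin N)))
      (fun i => Metric.ball (u i) (r i / 2)) := by
    intro i _ j _ hij
    apply Metric.ball_disjoint_ball
    have h1 := hsep i j hij
    have h2 := hsep j i hij.symm
    rw [dist_comm] at h2
    linarith
  have hsub : (⋃ i ∈ (Finset.univ : Finset (Fin N)), Metric.ball (u i) (r i / 2)) ⊆
      Metric.closedBall (fun _ => (1/2:ℝ)) 1 := by
    intro z hz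
    simp only [Set.mem_iUnion] at hz
    obtain ⟨i, _, hz⟩ := hz
    rw [Metric.mem_ball] at hz
    rw [Metric.mem_closedBall]
    have : dist (u i) (fun _ => (1/2:ℝ)) ≤ 1/2 := by
      rw [dist_pi_le_iff (by norm_num)]
      intro j
      rw [Real.dist_eq, abs_le]
      have := hu i j
      constructor <;> linarith [this.1, this.2]
    have h3 := dist_triangle z (u i) (fun _ => (1/2:ℝ))
    have := hr1 i
    linarith
  have h := measure_mono (μ := volume) hsub
  rw [measure_biUnion_finset hdisj (fun i _ => Metric.isOpen_ball.measurableSet),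
    Real.volume_pi_closedBall _ (by norm_num)] at h
  simp only [hvol] at h
  rw [← ENNReal.ofReal_sum_of_nonneg (fun i _ => pow_nonneg (hr i) _)] at h
  rw [ENNReal.ofReal_le_ofReal_iff (by positivity)] at h
  simpa using h

lemma aux_pack2 (κ N : ℕ) (hκ : 2 ≤ κ) (hN : 0 < N) (r : Fin N → ℝ) (hr : ∀ i, 0 ≤ r i)
    (h : ∑ i, r i ^ κ ≤ 2 ^ κ) :
    ∑ i, r i ^ 2 ≤ (1 + 2 ^ κ) * (N * (N:ℝ) ^ (-2 / (κ:ℝ))) := by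
  have hN' : (0:ℝ) < N := by exact_mod_cast hN
  have hk : (0:ℝ) < κ := by positivity
  set t : ℝ := (N:ℝ) ^ (-1 / (κ:ℝ)) with ht
  have ht0 : 0 < t := by positivity
  have ht2 : (N:ℝ) ^ (-2 / (κ:ℝ)) = t ^ 2 := by
    rw [ht, ← Real.rpow_natCast, ← Real.rpow_mul hN'.le]; congr 1; push_cast; ring
  have htk : (N:ℝ) * t ^ κ = 1 := by
    rw [ht, ← Real.rpow_natCast, ← Real.rpow_mul hN'.le, div_mul_cancel₀ _ hk.ne', Real.rpow_neg_one]
    field_simp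
  obtain ⟨m, rfl⟩ := Nat.exists_eq_add_of_le hκ
  rw [ht2]
  have key : ∀ i, r i ^ 2 ≤ t ^ 2 + r i ^ (2 + m) * (N * t ^ 2) := by
    intro i
    rcases le_total (r i) t with h1 | h1
    · have : r i ^ 2 ≤ t ^ 2 := pow_le_pow_left₀ (hr i) h1 2
      have : 0 ≤ r i ^ (2 + m) * (N * t ^ 2) := by have := hr i; positivity
      linarith
    · have h2 : t ^ m ≤ r i ^ m := pow_le_pow_left₀ ht0.le h1 m
      have h3 : r i ^ 2 = r i ^ 2 * (N * t ^ (2 + m)) := by rw [htk, mul_one]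
      have h4 : r i ^ 2 * (N * t ^ (2 + m)) ≤ r i ^ (2 + m) * (N * t ^ 2) := by
        have : 0 ≤ r i ^ 2 * N * t ^ 2 := by positivity
        calc _ = (r i ^ 2 * N * t ^ 2) * t ^ m := by ring
          _ ≤ (r i ^ 2 * N * t ^ 2) * r i ^ m := mul_le_mul_of_nonneg_left h2 this
          _ = _ := by ring
      nlinarith [sq_nonneg t]
  calc ∑ i, r i ^ 2 ≤ ∑ i, (t ^ 2 + r i ^ (2 + m) * (N * t ^ 2)) := Finset.sum_le_sum fun i _ => key i
    _ = N * t ^ 2 + (∑ i, r i ^ (2 + m)) * (N * t ^ 2) := by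
      rw [Finset.sum_add_distrib, ← Finset.sum_mul]; simp
    _ ≤ N * t ^ 2 + 2 ^ (2 + m) * (N * t ^ 2) := by gcongr
    _ = _ := by ring

/-- Euclidean distance of the coordinates selected by `T`. -/
noncomputable def auxD {d κ : ℕ} (T : Fin κ → Fin d) (a b : Fin d → ℝ) : ℝ :=
  Real.sqrt (∑ j, (a (T j) - b (T j)) ^ 2)

lemma auxD_comm {d κ : ℕ} (T : Fin κ → Fin d) (a b : Fin d → ℝ) : auxD T a b = auxD T b a := by
  unfold auxD; congr 1; apply Finset.sum_congr rfl; intros; ring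

lemma auxD_nonneg {d κ : ℕ} (T : Fin κ → Fin d) (a b : Fin d → ℝ) : 0 ≤ auxD T a b :=
  Real.sqrt_nonneg _

lemma auxD_sq_le {d κ : ℕ} (T : Fin κ → Fin d) (a b : Fin d → ℝ) :
    auxD T a b ^ 2 ≤ κ * dist (fun j => a (T j)) (fun j => b (T j)) ^ 2 := by
  unfold auxD
  rw [Real.sq_sqrt (Finset.sum_nonneg fun _ _ => sq_nonneg _)]
  calc _ ≤ ∑ j : Fin κ, dist (fun j => a (T j)) (fun j => b (T j)) ^ 2 := by
        apply Finset.sum_le_sum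
        intro j _
        have := dist_le_pi_dist (fun j => a (T j)) (fun j => b (T j)) j
        rw [Real.dist_eq] at this
        rw [← sq_abs]
        exact pow_le_pow_left₀ (abs_nonneg _) this 2
    _ = _ := by simp

/-- Consistency of the sample with an `L`-Lipschitz function of the coordinates `T`. -/
def auxCons {d κ n : ℕ} (L : ℝ) (T : Fin κ → Fin d)
    (z : (Fin n → ((Fin d → ℝ) × ℝ)) × (Fin d → ℝ)) : Prop :=
  ∀ k k', |(z.1 k).2 - (z.1 k').2| ≤ L * auxD T (z.1 k).1 (z.1 k').1

/-- Clipped McShane extension. -/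
noncomputable def auxG {d κ n : ℕ} (hn : (Finset.univ : Finset (Fin n)).Nonempty) (L : ℝ)
    (T : Fin κ → Fin d) (z : (Fin n → ((Fin d → ℝ) × ℝ)) × (Fin d → ℝ)) : ℝ :=
  min 1 (max 0 (Finset.univ.sup' hn
    (fun (k : Fin n) => (z.1 k).2 - L * auxD T z.2 (z.1 k).1)))

lemma auxG_meas {d κ n : ℕ} (hn : (Finset.univ : Finset (Fin n)).Nonempty) (L : ℝ)
    (T : Fin κ → Fin d) : Measurable (auxG (d := d) hn L T) := by
  unfold auxG
  refine Measurable.min measurable_const (Measurable.max measurable_const ?_)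
  have : Measurable (Finset.univ.sup' hn (fun (k : Fin n)
     (z : (Fin n → ((Fin d → ℝ) × ℝ)) × (Fin d → ℝ)) => (z.1 k).2 - L * auxD T z.2 (z.1 k).1)) := by
    apply Finset.measurable_sup'
    intro k _
    unfold auxD
    fun_prop
  convert this using 1
  ext z
  simp [Finset.sup'_apply]

lemma auxCons_meas {d κ n : ℕ} (L : ℝ) (T : Fin κ → Fin d) :
    MeasurableSet {z | auxCons (n := n) L T z} := by
  unfold auxCons
  simp only [Set.ofPred_forall]
  refine MeasurableSet.iInter fun k => MeasurableSet.iInter fun k' => ?_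
  unfold auxD
  apply measurableSet_le
  · fun_prop
  · fun_prop

lemma aux_f {d κ n : ℕ} (hd : 0 < d) (hn : (Finset.univ : Finset (Fin n)).Nonempty) (L : ℝ) :
    ∃ f : (Fin n → ((Fin d → ℝ) × ℝ)) × (Fin d → ℝ) → ℝ, Measurable f ∧
      ∀ z, (∃ T : Fin κ → Fin d, auxCons L T z) → ∃ T : Fin κ → Fin d,
        auxCons L T z ∧ f z = auxG hn L T z := by
  classical
  have : Nonempty (Fin κ → Fin d) := ⟨fun _ => ⟨0, hd⟩⟩
  let h : (Fin κ → Fin d) → ((Fin n → ((Fin d → ℝ) × ℝ)) × (Fin d → ℝ)) → ℝ := fun T =>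
    Set.indicator {z | auxCons L T z} (auxG hn L T)
  refine ⟨Finset.univ.sup' Finset.univ_nonempty h, ?_, ?_⟩
  · exact Finset.measurable_sup' _ fun T _ => (auxG_meas hn L T).indicator (auxCons_meas L T)
  · rintro z ⟨T₀, hT₀⟩
    rw [Finset.sup'_apply]
    obtain ⟨T₁, _, hT₁⟩ := Finset.exists_mem_eq_sup' (Finset.univ_nonempty) (fun T => h T z)
    have hle : h T₀ z ≤ Finset.univ.sup' Finset.univ_nonempty (fun T => h T z) :=
      Finset.le_sup' (fun T => h T z) (Finset.mem_univ T₀)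
    have h0 : h T₀ z = auxG hn L T₀ z := Set.indicator_of_mem (s := {z | auxCons L T₀ z}) hT₀ _
    by_cases hc : auxCons L T₁ z
    · exact ⟨T₁, hc, hT₁.trans (Set.indicator_of_mem (s := {z | auxCons L T₁ z}) hc _)⟩
    · have h1 : h T₁ z = 0 := Set.indicator_of_notMem (s := {z | auxCons L T₁ z}) hc _
      refine ⟨T₀, hT₀, ?_⟩
      apply le_antisymm
      · rw [hT₁, h1]; exact le_min zero_le_one (le_max_left _ _)
      · rw [← h0]; exact hle

lemma auxG_err {d κ n : ℕ} (hn : (Finset.univ : Finset (Fin n)).Nonempty) (L : ℝ) (hL : 0 < L)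
    (T : Fin κ → Fin d) (z : (Fin n → ((Fin d → ℝ) × ℝ)) × (Fin d → ℝ)) (y : ℝ)
    (hy : y ∈ Set.Icc (0:ℝ) 1)
    (hc : ∀ k, |y - (z.1 k).2| ≤ L * auxD T z.2 (z.1 k).1) (k : Fin n) :
    (y - auxG hn L T z) ^ 2 ≤ 4 * L ^ 2 * auxD T z.2 (z.1 k).1 ^ 2 := by
  have h1 : auxG hn L T z ≤ y := by
    unfold auxG
    apply (min_le_right _ _).trans
    apply max_le hy.1
    apply Finset.sup'_le
    intro j _
    have := (abs_le.1 (hc j)).1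
    linarith
  have h2 : y - 2 * (L * auxD T z.2 (z.1 k).1) ≤ auxG hn L T z := by
    have h0 := mul_nonneg hL.le (auxD_nonneg T z.2 (z.1 k).1)
    unfold auxG
    apply le_min
    · linarith [hy.2]
    · apply le_max_of_le_right
      refine le_trans ?_ (Finset.le_sup' (fun (k : Fin n) => (z.1 k).2 - L * auxD T z.2 (z.1 k).1)
        (Finset.mem_univ k))
      have := (abs_le.1 (hc k)).2
      linarith
  calc (y - auxG hn L T z) ^ 2 ≤ (2 * (L * auxD T z.2 (z.1 k).1)) ^ 2 :=
        pow_le_pow_left₀ (by linarith) (by linarith) 2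
    _ = _ := by ring

lemma aux_err_one {d κ n : ℕ} (hn : (Finset.univ : Finset (Fin n)).Nonempty) (L : ℝ)
    (T : Fin κ → Fin d) (z : (Fin n → ((Fin d → ℝ) × ℝ)) × (Fin d → ℝ)) (y : ℝ)
    (hy : y ∈ Set.Icc (0:ℝ) 1) : (y - auxG hn L T z) ^ 2 ≤ 1 := by
  have h0 : 0 ≤ auxG hn L T z := le_min zero_le_one (le_max_left _ _)
  have h1 : auxG hn L T z ≤ 1 := min_le_left _ _
  rw [sq_le_one_iff_abs_le_one, abs_le]
  constructor <;> linarith [hy.1, hy.2]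

/-- Leave-one-out sample. -/
def auxZ {d n : ℕ} (x : Fin (n+1) → Fin d → ℝ) (y : Fin (n+1) → ℝ) (i : Fin (n+1)) :
    (Fin n → ((Fin d → ℝ) × ℝ)) × (Fin d → ℝ) :=
  (fun k => (x (Equiv.swap i (Fin.last n) k.castSucc), y (Equiv.swap i (Fin.last n) k.castSucc)), x i)

lemma aux_idx {n : ℕ} (i j : Fin (n+1)) (h : j ≠ i) :
    ∃ k : Fin n, Equiv.swap i (Fin.last n) k.castSucc = j := by
  have : Equiv.swap i (Fin.last n) j ≠ Fin.last n := by
    intro h'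
    rw [Equiv.swap_apply_eq_iff] at h'
    simp at h'
    exact h h'
  obtain ⟨k, hk⟩ := Fin.exists_castSucc_eq.2 this
  exact ⟨k, by rw [hk]; simp⟩

lemma aux_det_T {d κ n : ℕ} (hκ : 2 ≤ κ) (hn2 : 2 ≤ n)
    (hn : (Finset.univ : Finset (Fin n)).Nonempty) (L : ℝ) (hL : 0 < L)
    (T : Fin κ → Fin d) (x : Fin (n+1) → Fin d → ℝ) (y : Fin (n+1) → ℝ)
    (hx : ∀ i j, x i j ∈ Set.Icc (0:ℝ) 1) (hy : ∀ i, y i ∈ Set.Icc (0:ℝ) 1) :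
    ∑ i, Set.indicator {i | auxCons L T (auxZ x y i)}
      (fun i => (y i - auxG hn L T (auxZ x y i)) ^ 2) i ≤
      2 + 4 * L ^ 2 * (κ * ((1 + 2 ^ κ) * ((n + 1 : ℕ) * ((n + 1 : ℕ):ℝ) ^ (-2 / (κ:ℝ))))) := by
  classical
  set K : ℝ := 4 * L ^ 2 * (κ * ((1 + 2 ^ κ) * ((n + 1 : ℕ) * ((n + 1 : ℕ):ℝ) ^ (-2 / (κ:ℝ))))) with hK
  have hK0 : 0 ≤ K := by positivity
  by_cases hall : ∀ a b, |y a - y b| ≤ L * auxD T (x a) (x b)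
  · -- globally consistent
    have hex : ∀ i : Fin (n+1), ∃ k : Fin n, ∀ j, j ≠ i →
        dist (fun l => x i (T l)) (fun l => x (Equiv.swap i (Fin.last n) k.castSucc) (T l)) ≤
        dist (fun l => x i (T l)) (fun l => x j (T l)) := by
      intro i
      obtain ⟨k, _, hk⟩ := Finset.exists_min_image Finset.univ (fun k : Fin n =>
        dist (fun l => x i (T l)) (fun l => x (Equiv.swap i (Fin.last n) k.castSucc) (T l))) hn
      refine ⟨k, fun j hj => ?_⟩
      obtain ⟨k', rfl⟩ := aux_idx i j hj
      exact hk k' (Finset.mem_univ _)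
    choose k hk using hex
    set r : Fin (n+1) → ℝ := fun i =>
      dist (fun l => x i (T l)) (fun l => x (Equiv.swap i (Fin.last n) (k i).castSucc) (T l)) with hr
    have hr1 : ∀ i, r i ≤ 1 := by
      intro i
      rw [hr]
      simp only
      rw [dist_pi_le_iff (by norm_num)]
      intro l
      have h1 := hx i (T l)
      have h2 := hx (Equiv.swap i (Fin.last n) (k i).castSucc) (T l)
      rw [Real.dist_eq, abs_le]
      constructor <;> linarith [h1.1, h1.2, h2.1, h2.2]
    have hp := aux_pack κ (n+1) (fun i l => x i (T l)) (fun i l => hx i (T l)) r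
      (fun i => dist_nonneg) hr1 (fun i j hij => hk i j hij.symm) (by omega)
    have hp2 := aux_pack2 κ (n+1) hκ (by omega) r (fun i => dist_nonneg) hp
    have : ∀ i, Set.indicator {i | auxCons L T (auxZ x y i)}
      (fun i => (y i - auxG hn L T (auxZ x y i)) ^ 2) i ≤ 4 * L ^ 2 * (κ * r i ^ 2) := by
      intro i
      refine (Set.indicator_le_self' (fun _ _ => sq_nonneg _) i).trans ?_
      refine (auxG_err hn L hL T (auxZ x y i) (y i) (hy i) (fun k => hall _ _) (k i)).trans ?_
      exact mul_le_mul_of_nonneg_left (auxD_sq_le T _ _) (by positivity)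
    calc _ ≤ ∑ i, 4 * L ^ 2 * (κ * r i ^ 2) := Finset.sum_le_sum fun i _ => this i
      _ = 4 * L ^ 2 * (κ * ∑ i, r i ^ 2) := by rw [← Finset.mul_sum, ← Finset.mul_sum]
      _ ≤ K := by rw [hK]; gcongr
      _ ≤ 2 + K := by linarith
  · push Not at hall
    obtain ⟨a, b, hab⟩ := hall
    have : ∀ i, Set.indicator {i | auxCons L T (auxZ x y i)}
      (fun i => (y i - auxG hn L T (auxZ x y i)) ^ 2) i ≤
        (if i = a then 1 else 0) + (if i = b then (1:ℝ) else 0) := by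
      intro i
      by_cases hi : i = a ∨ i = b
      · have h1 : Set.indicator {i | auxCons L T (auxZ x y i)}
          (fun i => (y i - auxG hn L T (auxZ x y i)) ^ 2) i ≤ 1 :=
          (Set.indicator_le_self' (fun _ _ => sq_nonneg _) i).trans
            (aux_err_one hn L T _ _ (hy i))
        refine h1.trans ?_
        rcases hi with hi | hi
        · rw [if_pos hi]; split_ifs <;> norm_num
        · rw [if_pos hi]; split_ifs <;> norm_num
      · push Not at hi
        rw [Set.indicator_of_notMem, if_neg hi.1, if_neg hi.2]
        · norm_num
        · intro hc
          obtain ⟨ka, hka⟩ := aux_idx i a hi.1.symm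
          obtain ⟨kb, hkb⟩ := aux_idx i b hi.2.symm
          have := hc ka kb
          simp only [auxZ, hka, hkb] at this
          linarith
    calc _ ≤ ∑ i, ((if i = a then 1 else 0) + (if i = b then (1:ℝ) else 0)) :=
          Finset.sum_le_sum fun i _ => this i
      _ = 2 := by rw [Finset.sum_add_distrib]; simp; norm_num
      _ ≤ 2 + K := by linarith

lemma aux_int {d n : ℕ} (μ : Measure (Fin d → ℝ)) [IsProbabilityMeasure μ]
    (F : (Fin (n+1) → Fin d → ℝ) → ℝ) (hF : Measurable F) (B : ℝ)
    (hcube : ∀ᵐ a ∂μ, ∀ i, a i ∈ Set.Icc (0:ℝ) 1)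
    (h1 : ∀ x : Fin (n+1) → Fin d → ℝ, (∀ i j, x i j ∈ Set.Icc (0:ℝ) 1) → |F x| ≤ 1)
    (h2 : ∀ x : Fin (n+1) → Fin d → ℝ, (∀ i j, x i j ∈ Set.Icc (0:ℝ) 1) →
      ∑ i, F (fun k => x (Equiv.swap i (Fin.last n) k)) ≤ B) :
    (n + 1) * ∫ x, F x ∂(Measure.pi fun _ : Fin (n+1) => μ) ≤ B := by
  set P := Measure.pi fun _ : Fin (n+1) => μ with hP
  have hae : ∀ᵐ x ∂P, ∀ i j, x i j ∈ Set.Icc (0:ℝ) 1 := by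
    rw [ae_all_iff]
    intro i
    exact (Measure.tendsto_eval_ae_ae (μ := fun _ : Fin (n+1) => μ) (i := i)).eventually hcube
  have hmp : ∀ i : Fin (n+1), MeasurePreserving
      (fun (x : Fin (n+1) → Fin d → ℝ) k => x (Equiv.swap i (Fin.last n) k)) P P := by
    intro i
    have := measurePreserving_piCongrLeft (fun _ : Fin (n+1) => μ) (Equiv.swap i (Fin.last n))
    convert this using 1
    ext x k
    have := Equiv.piCongrLeft_apply_apply (fun _ => Fin d → ℝ) (Equiv.swap i (Fin.last n)) x
      (Equiv.swap i (Fin.last n) k)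
    rw [MeasurableEquiv.coe_piCongrLeft]
    simp at this
    rw [this]
  have hint : Integrable F P := by
    refine Integrable.of_bound hF.aestronglyMeasurable 1 ?_
    filter_upwards [hae] with x hx using h1 x hx
  have hinti : ∀ i : Fin (n+1), Integrable
      (fun x => F (fun k => x (Equiv.swap i (Fin.last n) k))) P := fun i =>
    (hmp i).integrable_comp_of_integrable hint
  have heq : ∀ i : Fin (n+1), ∫ x, F (fun k => x (Equiv.swap i (Fin.last n) k)) ∂P = ∫ x, F x ∂P := by
    intro i
    rw [← (hmp i).map_eq, integral_map (hmp i).measurable.aemeasurable hF.aestronglyMeasurable,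
      (hmp i).map_eq]
  calc (n + 1) * ∫ x, F x ∂P
      = ∑ i : Fin (n+1), ∫ x, F (fun k => x (Equiv.swap i (Fin.last n) k)) ∂P := by
        simp [heq]
    _ = ∫ x, ∑ i : Fin (n+1), F (fun k => x (Equiv.swap i (Fin.last n) k)) ∂P :=
        (integral_finsetSum _ fun i _ => hinti i).symm
    _ ≤ ∫ x, B ∂P := by
        apply integral_mono_ae (integrable_finsetSum _ fun i _ => hinti i) (integrable_const _)
        filter_upwards [hae] with x hx using h2 x hx
    _ = B := by simp


/-- Proposition 4.3, upper bound: for each `n ≥ 2` there is a measurable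
ICL decoder `f` operating on the raw feature columns such that, for every sampling density
on `[0,1]^d` bounded between `pmin` and `pmax`, and for every `L`-Lipschitz target
`π : [0,1]^κ → [0,1]` (Lipschitz w.r.t. the Euclidean norm), the expected squared test error
(averaged uniformly over the randomly drawn size-`κ` coordinate subset, represented as a
uniformly random injection `S : Fin κ → Fin d`, and over the i.i.d. samples) is at most
`C (n^{−2/κ} + √(log(2 C(d,κ))/n))`, with `C` depending only on `d`, `κ`, `L`. -/
theorem stmt_11 (d κ : ℕ) (hκ : 2 ≤ κ) (hκd : κ ≤ d) (L : ℝ) (hL : 0 < L) :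
    ∃ C : ℝ, 0 < C ∧
      ∀ n : ℕ, 2 ≤ n →
        ∃ f : (Fin n → ((Fin d → ℝ) × ℝ)) × (Fin d → ℝ) → ℝ, Measurable f ∧
          ∀ (p : (Fin d → ℝ) → ℝ≥0∞), Measurable p →
          ∀ pmin pmax : ℝ, 0 < pmin → pmin ≤ pmax →
            (∀ x, (∀ i, x i ∈ Set.Icc (0 : ℝ) 1) →
              ENNReal.ofReal pmin ≤ p x ∧ p x ≤ ENNReal.ofReal pmax) →
            (∀ x, ¬ (∀ i, x i ∈ Set.Icc (0 : ℝ) 1) → p x = 0) →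
          ∀ (μ : Measure (Fin d → ℝ)), μ = volume.withDensity p →
            ∀ [IsProbabilityMeasure μ],
          ∀ π : (Fin κ → ℝ) → ℝ, Measurable π →
            (∀ u, (∀ j, u j ∈ Set.Icc (0 : ℝ) 1) → π u ∈ Set.Icc (0 : ℝ) 1) →
            (∀ u v : Fin κ → ℝ, (∀ j, u j ∈ Set.Icc (0 : ℝ) 1) →
              (∀ j, v j ∈ Set.Icc (0 : ℝ) 1) →
              |π u - π v| ≤ L * Real.sqrt (∑ j, (u j - v j) ^ 2)) →
          ((Finset.univ.filter fun S : Fin κ → Fin d => Function.Injective S).card : ℝ)⁻¹ *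
            ∑ S ∈ Finset.univ.filter fun S : Fin κ → Fin d => Function.Injective S,
              ∫ x : Fin (n + 1) → (Fin d → ℝ),
                  (π (fun j => x (Fin.last n) (S j)) -
                    f (fun i : Fin n =>
                        (x i.castSucc, π fun j => x i.castSucc (S j)),
                      x (Fin.last n))) ^ 2
                ∂(Measure.pi fun _ => μ) ≤
            C * ((n : ℝ) ^ (-2 / (κ : ℝ)) +
              Real.sqrt (Real.log (2 * (d.choose κ : ℝ)) / n)) := by
  classical
  set K : ℝ := (d:ℝ) ^ κ * (2 + 4 * L ^ 2 * (κ * (1 + 2 ^ κ))) with hK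
  have hd : 0 < d := by omega
  have hd' : (0:ℝ) < d := by exact_mod_cast hd
  have hK0 : 0 < K := by positivity
  refine ⟨K, hK0, fun n hn2 => ?_⟩
  have hn : (Finset.univ : Finset (Fin n)).Nonempty := ⟨⟨0, by omega⟩, Finset.mem_univ _⟩
  obtain ⟨f, hf, hfT⟩ := aux_f (κ := κ) hd hn L
  refine ⟨f, hf, ?_⟩
  intro p hp pmin pmax hpmin hpm hpc hp0 μ hμ _ π hπ hπ01 hπL
  have hn0 : (0:ℝ) < n := by positivity
  have hcube : ∀ᵐ a ∂μ, ∀ i, a i ∈ Set.Icc (0:ℝ) 1 := by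
    rw [hμ, ae_withDensity_iff hp]
    filter_upwards with a ha
    by_contra h
    exact ha (hp0 a h)
  have hrate : K * ((n : ℝ) ^ (-2 / (κ : ℝ))) ≤ K * ((n : ℝ) ^ (-2 / (κ : ℝ)) +
              Real.sqrt (Real.log (2 * (d.choose κ : ℝ)) / n)) := by
    apply mul_le_mul_of_nonneg_left _ hK0.le
    linarith [Real.sqrt_nonneg (Real.log (2 * (d.choose κ : ℝ)) / n)]
  refine le_trans ?_ hrate
  have hS : ∀ S : Fin κ → Fin d, ∫ x : Fin (n + 1) → (Fin d → ℝ),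
      (π (fun j => x (Fin.last n) (S j)) - f (fun i : Fin n =>
        (x i.castSucc, π fun j => x i.castSucc (S j)), x (Fin.last n))) ^ 2
          ∂(Measure.pi fun _ => μ) ≤ K * ((n : ℝ) ^ (-2 / (κ : ℝ))) := by
    intro S
    set R : ℝ := 4 * L ^ 2 * (κ * ((1 + 2 ^ κ) * ((n + 1 : ℕ) * ((n + 1 : ℕ):ℝ) ^ (-2 / (κ:ℝ)))))
      with hR
    have hcons : ∀ x : Fin (n+1) → Fin d → ℝ, (∀ i j, x i j ∈ Set.Icc (0:ℝ) 1) → ∀ i,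
        ∃ T : Fin κ → Fin d, auxCons L T (auxZ x (fun i => π fun j => x i (S j)) i) ∧
          f (auxZ x (fun i => π fun j => x i (S j)) i) =
            auxG hn L T (auxZ x (fun i => π fun j => x i (S j)) i) := by
      intro x hx i
      apply hfT
      exact ⟨S, fun k k' => hπL _ _ (fun j => hx _ _) (fun j => hx _ _)⟩
    have hF : Measurable fun x : Fin (n + 1) → (Fin d → ℝ) =>
      (π (fun j => x (Fin.last n) (S j)) - f (fun i : Fin n =>
        (x i.castSucc, π fun j => x i.castSucc (S j)), x (Fin.last n))) ^ 2 := by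
      fun_prop
    have hmain := aux_int μ _ hF ((d:ℝ) ^ κ * (2 + R)) hcube ?_ ?_
    · have hN0 : (0:ℝ) < ((n + 1 : ℕ):ℝ) := by positivity
      have hkk : (2:ℝ) ≤ κ := by exact_mod_cast hκ
      have hmono : ((n + 1 : ℕ):ℝ) ^ (-2 / (κ:ℝ)) ≤ (n:ℝ) ^ (-2 / (κ:ℝ)) := by
        apply Real.rpow_le_rpow_of_nonpos hn0 (by push_cast; linarith)
        apply div_nonpos_of_nonpos_of_nonneg <;> linarith
      have hone : 1 ≤ ((n + 1 : ℕ):ℝ) * (n:ℝ) ^ (-2 / (κ:ℝ)) := by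
        have h1 : (n:ℝ) ^ (-1:ℝ) ≤ (n:ℝ) ^ (-2 / (κ:ℝ)) := by
          apply Real.rpow_le_rpow_of_exponent_le
          · exact_mod_cast (by omega : 1 ≤ n)
          · rw [le_div_iff₀ (by linarith)]; linarith
        rw [Real.rpow_neg_one] at h1
        calc (1:ℝ) = n * (n:ℝ)⁻¹ := by field_simp
          _ ≤ ((n + 1 : ℕ):ℝ) * (n:ℝ) ^ (-2 / (κ:ℝ)) := by
            apply mul_le_mul (by push_cast; linarith) h1 (by positivity) hN0.le
      have hfin : (d:ℝ) ^ κ * (2 + R) ≤ (n + 1) * (K * ((n : ℝ) ^ (-2 / (κ : ℝ)))) := by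
        have hR' : R ≤ 4 * L ^ 2 * (κ * ((1 + 2 ^ κ) *
            ((n + 1 : ℕ) * (n:ℝ) ^ (-2 / (κ:ℝ))))) := by
          rw [hR]; gcongr
        calc (d:ℝ) ^ κ * (2 + R) ≤ (d:ℝ) ^ κ * (2 * (((n + 1 : ℕ):ℝ) * (n:ℝ) ^ (-2 / (κ:ℝ))) +
              4 * L ^ 2 * (κ * ((1 + 2 ^ κ) * ((n + 1 : ℕ) * (n:ℝ) ^ (-2 / (κ:ℝ)))))) := by
              apply mul_le_mul_of_nonneg_left _ (by positivity)
              linarith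
          _ = _ := by rw [hK]; push_cast; ring
      have hpos : (0:ℝ) < n + 1 := by positivity
      exact le_of_mul_le_mul_left (hmain.trans hfin) hpos
    · intro x hx
      obtain ⟨T, _, hT⟩ := hcons x hx (Fin.last n)
      have h1 := aux_err_one hn L T (auxZ x (fun i => π fun j => x i (S j)) (Fin.last n))
        (π (fun j => x (Fin.last n) (S j))) (hπ01 _ fun j => hx _ _)
      rw [← hT] at h1
      simp only [auxZ, Equiv.swap_self, Equiv.refl_apply] at h1
      rw [abs_of_nonneg (sq_nonneg _)]
      exact h1
    · intro x hx
      set y : Fin (n+1) → ℝ := fun i => π fun j => x i (S j) with hy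
      have hy01 : ∀ i, y i ∈ Set.Icc (0:ℝ) 1 := fun i => hπ01 _ fun j => hx _ _
      calc _ = ∑ i, (y i - f (auxZ x y i)) ^ 2 := by
            apply Finset.sum_congr rfl
            intro i _
            simp [hy, auxZ]
        _ ≤ ∑ i, ∑ T : Fin κ → Fin d, Set.indicator {i | auxCons L T (auxZ x y i)}
              (fun i => (y i - auxG hn L T (auxZ x y i)) ^ 2) i := by
            apply Finset.sum_le_sum
            intro i _
            obtain ⟨T, hTc, hT⟩ := hcons x hx i
            rw [hT]
            have h3 := Finset.single_le_sum (f := fun T : Fin κ → Fin d =>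
              Set.indicator {i | auxCons L T (auxZ x y i)}
              (fun i => (y i - auxG hn L T (auxZ x y i)) ^ 2) i) (s := Finset.univ)
              (fun T _ => Set.indicator_nonneg (fun _ _ => sq_nonneg _) _) (Finset.mem_univ T)
            refine le_trans (le_of_eq ?_) h3
            exact (Set.indicator_of_mem (s := {i | auxCons L T (auxZ x y i)}) hTc
              (fun i => (y i - auxG hn L T (auxZ x y i)) ^ 2)).symm
        _ = ∑ T : Fin κ → Fin d, ∑ i, Set.indicator {i | auxCons L T (auxZ x y i)}
              (fun i => (y i - auxG hn L T (auxZ x y i)) ^ 2) i := Finset.sum_comm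
        _ ≤ ∑ T : Fin κ → Fin d, (2 + R) := Finset.sum_le_sum fun T _ =>
            aux_det_T hκ hn2 hn L hL T x y hx hy01
        _ = (d:ℝ) ^ κ * (2 + R) := by simp; ring
  set A := Finset.univ.filter fun S : Fin κ → Fin d => Function.Injective S with hA
  have hB0 : 0 ≤ K * ((n : ℝ) ^ (-2 / (κ : ℝ))) := by positivity
  have hsum := Finset.sum_le_card_nsmul A _ _ fun S _ => hS S
  rw [nsmul_eq_mul] at hsum
  calc _ ≤ (A.card : ℝ)⁻¹ * (A.card * (K * ((n : ℝ) ^ (-2 / (κ : ℝ))))) :=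
        mul_le_mul_of_nonneg_left hsum (by positivity)
    _ ≤ _ := by
      rw [← mul_assoc]
      apply mul_le_of_le_one_left hB0
      exact inv_mul_le_one
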